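/- arXiv:1611.03280 — 2 statements merged into one kernel-verified Lean document; each statement's English description precedes it below -/
import Mathlib

section
/- Let R be a commutative noetherian ring, a an ideal of R, and M an R-module that is a-adically complete (the natural map from M to its a-adic completion is an isomorphism). If, for some integer n ≥ 1, Tor_n^R(R/p, M) = 0 holds for every prime ideal p containing a, then Tor_n^R(N, M) = 0 for every R-module N; consequently the flat dimension of M is at most n − 1. -/
open CategoryTheory Opposite

noncomputable section

/-- The `n`-th Ext group of `R`-modules `X` and `M`, i.e. `Ext^n_R(X, M)`. -/
def extModule (R : Type) [CommRing R] (n : ℕ) (X M : ModuleCat R) : ModuleCat R :=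
  ((Ext R (ModuleCat R) n).obj (op X)).obj M

/-- The `n`-th Tor group of `R`-modules `X` and `M`, i.e. `Tor_n^R(X, M)`. -/
def torModule (R : Type) [CommRing R] (n : ℕ) (X M : ModuleCat R) : ModuleCat R :=
  ((Tor (ModuleCat R) n).obj X).obj M

/-- The residue field `k(p) = R_p / p R_p` at a prime ideal `p`. -/
abbrev resField (R : Type) [CommRing R] (p : Ideal R) [p.IsPrime] : Type :=
  IsLocalRing.ResidueField (Localization.AtPrime p)


section DerivedComplete

variable {R : Type*} [CommRing R] (x : R)

/-- The map `(tᵢ) ↦ (tᵢ - x tᵢ₊₁)` on sequences in `T`. A module is derived `x`-complete precisely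
when this map is bijective. -/
def telescope (T : Type*) [AddCommGroup T] [Module R T] : (ℕ → T) →ₗ[R] (ℕ → T) where
  toFun t i := t i - x • t (i + 1)
  map_add' s t := by ext i; simp only [Pi.add_apply, smul_add]; abel
  map_smul' r t := by ext i; simp [smul_sub, smul_comm r x]

variable {x} {A B C : Type*} [AddCommGroup A] [Module R A] [AddCommGroup B] [Module R B]
  [AddCommGroup C] [Module R C]

@[simp]
lemma telescope_apply (t : ℕ → A) (i : ℕ) : telescope x A t i = t i - x • t (i + 1) := rfl

lemma telescope_map (f : A →ₗ[R] B) (t : ℕ → A) :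
    telescope x B (fun i ↦ f (t i)) = fun i ↦ f (telescope x A t i) := by
  ext i; simp

lemma telescope_surjective_of_surjective (f : A →ₗ[R] B) (hf : Function.Surjective f)
    (hA : Function.Surjective (telescope x A)) : Function.Surjective (telescope x B) := by
  intro s
  choose s' hs' using fun i ↦ hf (s i)
  obtain ⟨t, rfl⟩ := hA s'
  exact ⟨fun i ↦ f (t i), by rw [telescope_map]; exact funext hs'⟩

lemma telescope_bijective_of_kernel (f : A →ₗ[R] B) (g : B →ₗ[R] C) (hf : Function.Injective f)
    (hfg : Function.Exact f g) (hB : Function.Bijective (telescope x B))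
    (hC : Function.Injective (telescope x C)) : Function.Bijective (telescope x A) := by
  constructor
  · rw [injective_iff_map_eq_zero]
    intro t ht
    have : (fun i ↦ f (t i)) = 0 := by
      apply (injective_iff_map_eq_zero _).1 hB.1
      rw [telescope_map, ht]
      ext; simp
    ext i
    exact (injective_iff_map_eq_zero f).1 hf _ (congrFun this i)
  · intro s
    obtain ⟨b, hb⟩ := hB.2 (fun i ↦ f (s i))
    have hgb : (fun i ↦ g (b i)) = 0 := by
      apply (injective_iff_map_eq_zero _).1 hC
      rw [telescope_map, hb]
      ext i
      exact hfg.apply_apply_eq_zero _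
    choose t ht using fun i ↦ (hfg (b i)).1 (congrFun hgb i)
    refine ⟨t, funext fun i ↦ hf ?_⟩
    rw [← congrFun hb i, ← funext ht, telescope_map]

lemma telescope_injective_of_cokernel (f : A →ₗ[R] B) (g : B →ₗ[R] C)
    (hg : Function.Surjective g) (hfg : Function.Exact f g)
    (hA : Function.Surjective (telescope x A)) (hB : Function.Injective (telescope x B)) :
    Function.Injective (telescope x C) := by
  rw [injective_iff_map_eq_zero]
  intro t ht
  choose b hb using fun i ↦ hg (t i)
  have hgb (i) : g (telescope x B b i) = 0 := by
    rw [← congrFun (telescope_map g b) i, funext hb, ht]; rfl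
  choose u hu using fun i ↦ (hfg _).1 (hgb i)
  obtain ⟨v, rfl⟩ := hA u
  have : (fun i ↦ f (v i)) = b := hB (by rw [telescope_map]; exact funext hu)
  ext i
  rw [← hb, ← congrFun this i, hfg.apply_apply_eq_zero]; rfl

lemma telescope_bijective_of_linearEquiv (e : A ≃ₗ[R] B)
    (hB : Function.Bijective (telescope x B)) : Function.Bijective (telescope x A) :=
  telescope_bijective_of_kernel e.toLinearMap (0 : B →ₗ[R] PUnit) e.injective
    (fun b ↦ by simp) hB (Function.injective_of_subsingleton _)

lemma telescope_pi_bijective {ι : Type*} (h : Function.Bijective (telescope x A)) :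
    Function.Bijective (telescope x (ι → A)) := by
  constructor
  · intro s t hst
    ext i j
    refine congrFun (h.1 (a₁ := fun i ↦ s i j) (a₂ := fun i ↦ t i j) (funext fun i ↦ ?_)) i
    exact congrFun (congrFun hst i) j
  · intro s
    choose t ht using fun j ↦ h.2 (fun i ↦ s i j)
    exact ⟨fun i j ↦ t j i, funext fun i ↦ funext fun j ↦ congrFun (ht j) i⟩

lemma subsingleton_of_telescope_injective (h : Function.Injective (telescope x A))
    (hx : ∀ t : A, ∃ u, x • u = t) : Subsingleton A := by
  refine subsingleton_of_forall_eq 0 fun t ↦ ?_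
  choose d hd using hx
  have := (injective_iff_map_eq_zero _).1 h (fun i ↦ d^[i] t)
    (by ext i; simp [Function.iterate_succ_apply', hd])
  exact congrFun this 0

lemma IsAdicComplete.telescope_bijective (a : Ideal R) [IsAdicComplete a A] (hx : x ∈ a) :
    Function.Bijective (telescope x A) := by
  have hpow (k : ℕ) (y : A) : x ^ k • y ∈ (a ^ k • ⊤ : Submodule R A) :=
    Submodule.smul_mem_smul (Ideal.pow_mem_pow hx k) trivial
  constructor
  · rw [injective_iff_map_eq_zero]
    intro t ht
    have hs (i) : t i = x • t (i + 1) := sub_eq_zero.1 (congrFun ht i)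
    have hs' (k i) : t i = x ^ k • t (i + k) := by
      induction k generalizing i with
      | zero => simp
      | succ k ih => rw [hs, ih (i + 1), smul_smul, pow_succ', add_right_comm, add_assoc]
    ext i
    refine IsHausdorff.haus (I := a) inferInstance _ fun k ↦ ?_
    rw [SModEq.zero, hs' k]
    exact hpow k _
  · intro s
    let p (i k : ℕ) : A := ∑ j ∈ Finset.range k, x ^ j • s (i + j)
    have hp (i : ℕ) {m n : ℕ} (hmn : m ≤ n) :
        p i m ≡ p i n [SMOD (a ^ m • ⊤ : Submodule R A)] := by
      rw [SModEq.comm, SModEq.sub_mem, Finset.sum_range_sub_sum_range hmn]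
      refine Submodule.sum_mem _ fun j hj ↦ ?_
      have hj : m ≤ j := (Finset.mem_filter.1 hj).2
      exact Submodule.smul_mono_left (Ideal.pow_le_pow_right hj) (hpow j _)
    choose L hL using fun i ↦ IsPrecomplete.prec (I := a) inferInstance (hp i)
    refine ⟨L, funext fun i ↦ sub_eq_zero.1 <|
      IsHausdorff.haus (I := a) inferInstance _ fun k ↦ ?_⟩
    have h₁ := (hp i k.le_succ).symm.trans (hL i k)
    have h₂ := (hL (i + 1) k).smul x
    have h₃ : p i (k + 1) = s i + x • p (i + 1) k := by
      simp only [p, Finset.sum_range_succ', Finset.smul_sum, smul_smul, pow_succ', pow_zero,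
        one_smul, add_zero]
      rw [add_comm]
      simp only [add_assoc, add_comm 1]
    rw [h₃] at h₁
    rw [SModEq.sub_mem] at h₁ h₂
    rw [SModEq.zero, telescope_apply]
    convert neg_mem (add_mem h₁ (neg_mem h₂)) using 1
    abel

open TensorProduct

lemma telescope_tensorProduct_free_bijective (h : Function.Bijective (telescope x A)) (r : ℕ) :
    Function.Bijective (telescope x ((Fin r → R) ⊗[R] A)) :=
  telescope_bijective_of_linearEquiv
    (TensorProduct.comm R _ _ ≪≫ₗ TensorProduct.piScalarRight R R A (Fin r))
    (telescope_pi_bijective h)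

variable {N : Type*} [AddCommGroup N] [Module R N] [Module.Finite R N]

lemma telescope_tensorProduct_surjective (h : Function.Bijective (telescope x A)) :
    Function.Surjective (telescope x (N ⊗[R] A)) := by
  obtain ⟨k, g, hg⟩ := Module.Finite.exists_fin' R N
  exact telescope_surjective_of_surjective (g.rTensor A) (LinearMap.rTensor_surjective A hg)
    (telescope_tensorProduct_free_bijective h k).2

lemma telescope_tensorProduct_bijective [IsNoetherianRing R]
    (h : Function.Bijective (telescope x A)) :
    Function.Bijective (telescope x (N ⊗[R] A)) := by
  obtain ⟨r, f, hf⟩ := Module.Finite.exists_fin' R N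
  exact ⟨telescope_injective_of_cokernel ((LinearMap.ker f).subtype.rTensor A) (f.rTensor A)
    (LinearMap.rTensor_surjective A hf) (rTensor_exact A (LinearMap.exact_subtype_ker_map f) hf)
    (telescope_tensorProduct_surjective h) (telescope_tensorProduct_free_bijective h r).1,
    telescope_tensorProduct_surjective h⟩

end DerivedComplete

open MonoidalCategory

/-- The complex `N ⊗ K`, as a functor of `N`. -/
def tensorComplex {R : Type} [CommRing R] (K : ChainComplex (ModuleCat.{0} R) ℕ) :
    ModuleCat.{0} R ⥤ ChainComplex (ModuleCat.{0} R) ℕ where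
  obj N := ((tensorLeft N).mapHomologicalComplex _).obj K
  map f := (NatTrans.mapHomologicalComplex ((tensoringLeft _).map f) _).app K

section TensorComplex

variable {R : Type} [CommRing R] (K : ChainComplex (ModuleCat.{0} R) ℕ)

instance : (tensorComplex K).Additive where
  map_add {X Y f g} := by
    ext i : 1
    exact MonoidalPreadditive.add_whiskerRight f g

lemma tensorComplex_map_shortExact [∀ i, Module.Flat R (K.X i)]
    {S : ShortComplex (ModuleCat.{0} R)} (hS : S.ShortExact) :
    (S.map (tensorComplex K)).ShortExact :=
  HomologicalComplex.shortExact_of_degreewise_shortExact _ fun i ↦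
    hS.map_of_exact (tensorRight (K.X i))

lemma tensorComplex_homologyMap_smul (N : ModuleCat.{0} R) (x : R) (n : ℕ) :
    HomologicalComplex.homologyMap ((tensorComplex K).map (x • 𝟙 N)) n =
      x • 𝟙 (((tensorComplex K).obj N).homology n) := by
  have : (tensorComplex K).map (x • 𝟙 N) = x • 𝟙 _ := by
    ext i : 1
    refine (MonoidalLinear.smul_whiskerRight x (𝟙 N) (K.X i)).trans ?_
    rw [id_whiskerRight]
    rfl
  rw [this]
  change ShortComplex.homologyMap (x • 𝟙 (((tensorComplex K).obj N).sc n)) = _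
  rw [ShortComplex.homologyMap_smul, ShortComplex.homologyMap_id]
  rfl

/-- `Tor` is computed by a projective resolution of the second variable. -/
def torModuleIso {M : ModuleCat.{0} R} (P : ProjectiveResolution M) (N : ModuleCat.{0} R)
    (n : ℕ) : torModule R n N M ≅ ((tensorComplex P.complex).obj N).homology n :=
  P.isoLeftDerivedObj (tensorLeft N) n

/-- `Tor` in degree zero is the tensor product. -/
def torModuleZeroIso (N M : ModuleCat.{0} R) : torModule R 0 N M ≅ N ⊗ M :=
  (tensorLeft N).leftDerivedZeroIsoSelf.app M

end TensorComplex

section Resolution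

variable {R : Type} [CommRing R] {M : ModuleCat.{0} R} (P : ProjectiveResolution M)

instance (i : ℕ) : Module.Flat R (P.complex.X i) :=
  have : Module.Projective R (P.complex.X i) :=
    (IsProjective.iff_projective _).2 (P.projective i)
  inferInstance

lemma isZero_homology_of_flat (F : ModuleCat.{0} R) [Module.Flat R F] (n : ℕ) :
    Limits.IsZero (((tensorComplex P.complex).obj F).homology (n + 1)) := by
  rw [← HomologicalComplex.exactAt_iff_isZero_homology]
  rw [HomologicalComplex.exactAt_iff]
  exact Module.Flat.lTensor_shortComplex_exact F (P.complex.sc (n + 1))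
    ((HomologicalComplex.exactAt_iff _ _).1 (P.complex_exactAt_succ n))

lemma telescope_homology_bijective [IsNoetherianRing R] {x : R}
    (hM : Function.Bijective (telescope x M)) (n : ℕ) (N : ModuleCat.{0} R) [Module.Finite R N] :
    Function.Bijective (telescope x (((tensorComplex P.complex).obj N).homology n)) := by
  induction n generalizing N with
  | zero =>
    exact telescope_bijective_of_linearEquiv
      ((torModuleIso P N 0).symm ≪≫ torModuleZeroIso N M).toLinearEquiv
      (telescope_tensorProduct_bijective (N := N) hM)
  | succ n ih =>
    obtain ⟨r, f, hf⟩ := Module.Finite.exists_fin' R N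
    have hS := tensorComplex_map_shortExact P.complex (LinearMap.shortExact_shortComplexKer hf)
    refine telescope_bijective_of_kernel (hS.δ (n + 1) n rfl).hom _ ?_
      ((ShortComplex.ShortExact.moduleCat_exact_iff_function_exact _).1
        (hS.homology_exact₁ (n + 1) n rfl))
      (ih (ModuleCat.of R (LinearMap.ker f))) (ih (ModuleCat.of R (Fin r → R))).1
    refine (ModuleCat.mono_iff_injective _).1 ?_
    exact (hS.homology_exact₃ (n + 1) n rfl).mono_g
      ((isZero_homology_of_flat P (ModuleCat.of R (Fin r → R)) n).eq_of_src _ _)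

lemma subsingleton_homology_of_shortExact {S : ShortComplex (ModuleCat.{0} R)}
    (hS : S.ShortExact) {n : ℕ}
    (h₁ : Subsingleton (((tensorComplex P.complex).obj S.X₁).homology n))
    (h₃ : Subsingleton (((tensorComplex P.complex).obj S.X₃).homology n)) :
    Subsingleton (((tensorComplex P.complex).obj S.X₂).homology n) := by
  rw [← ModuleCat.isZero_iff_subsingleton] at h₁ h₃ ⊢
  exact ((tensorComplex_map_shortExact P.complex hS).homology_exact₂ n).isZero_of_both_zeros
    (h₁.eq_of_src _ _) (h₃.eq_of_tgt _ _)

lemma subsingleton_homology_of_linearEquiv {N N' : ModuleCat.{0} R} (e : N ≃ₗ[R] N') {n : ℕ}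
    (h : Subsingleton (((tensorComplex P.complex).obj N').homology n)) :
    Subsingleton (((tensorComplex P.complex).obj N).homology n) :=
  @Equiv.subsingleton _ _ ((tensorComplex P.complex ⋙ HomologicalComplex.homologyFunctor _ _ n).mapIso
    e.toModuleIso).toLinearEquiv.toEquiv h

/-- By dévissage, vanishing of `Tor` on the quotients `R ⧸ q` with `q` a prime containing `I`
implies vanishing on finitely generated modules killed by `I`. -/
lemma subsingleton_homology_of_le_annihilator [IsNoetherianRing R] {I : Ideal R} {n : ℕ}
    (h : ∀ q : Ideal R, q.IsPrime → I ≤ q →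
      Subsingleton (((tensorComplex P.complex).obj (ModuleCat.of R (R ⧸ q))).homology n))
    (N : ModuleCat.{0} R) [Module.Finite R N] (hN : I ≤ Module.annihilator R N) :
    Subsingleton (((tensorComplex P.complex).obj N).homology n) := by
  suffices H : ∀ (N : Type) [AddCommGroup N] [Module R N] [Module.Finite R N],
      I ≤ Module.annihilator R N →
      Subsingleton (((tensorComplex P.complex).obj (ModuleCat.of R N)).homology n) from H N hN
  intro N _ _ _
  induction ‹Module.Finite R N› using
    IsNoetherianRing.induction_on_isQuotientEquivQuotientPrime R with
  | subsingleton N =>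
    intro _
    rw [← ModuleCat.isZero_iff_subsingleton]
    exact (tensorComplex P.complex ⋙ HomologicalComplex.homologyFunctor _ _ n).map_isZero
      (ModuleCat.isZero_of_subsingleton _)
  | quotient N p e =>
    intro hN
    rw [e.annihilator_eq, Ideal.annihilator_quotient] at hN
    exact subsingleton_homology_of_linearEquiv P (N' := ModuleCat.of R (R ⧸ p.1)) e
      (h _ p.2 hN)
  | exact N₁ N₂ N₃ f g hf hg hfg h₁ h₃ =>
    intro hN
    exact subsingleton_homology_of_shortExact P
      (S := ModuleCat.shortComplexOfCompEqZero f g hfg.linearMap_comp_eq_zero)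
      (ModuleCat.shortComplex_shortExact _ hfg hf hg)
      (h₁ (hN.trans (f.annihilator_le_of_injective hf)))
      (h₃ (hN.trans (g.annihilator_le_of_surjective hg)))

lemma subsingleton_homology_quotient_prime [IsNoetherianRing R] (a : Ideal R) [IsAdicComplete a M]
    {n : ℕ} (h : ∀ q : Ideal R, q.IsPrime → a ≤ q →
      Subsingleton (((tensorComplex P.complex).obj (ModuleCat.of R (R ⧸ q))).homology n))
    (p : Ideal R) (hp : p.IsPrime) :
    Subsingleton (((tensorComplex P.complex).obj (ModuleCat.of R (R ⧸ p))).homology n) := by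
  induction p using WellFoundedGT.induction with
  | ind p ih =>
  by_cases hap : a ≤ p
  · exact h p hp hap
  obtain ⟨x, hxa, hxp⟩ := SetLike.not_le_iff_exists.1 hap
  let I := p ⊔ Ideal.span {x}
  have hxI : x ∈ I := Ideal.mem_sup_right (Ideal.mem_span_singleton_self x)
  have hpI : p ≤ I := le_sup_left
  have hI : Subsingleton
      (((tensorComplex P.complex).obj (ModuleCat.of R (R ⧸ I))).homology n) := by
    refine subsingleton_homology_of_le_annihilator P (I := I) (fun q hq hIq ↦ ?_) _
      (Ideal.annihilator_quotient (I := I)).ge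
    exact ih q (lt_of_le_of_ne (le_sup_left.trans hIq) fun hpq ↦ hxp (hpq ▸ hIq hxI)) hq
  let S : ShortComplex (ModuleCat.{0} R) := ModuleCat.shortComplexOfCompEqZero
    (x • LinearMap.id : (R ⧸ p) →ₗ[R] R ⧸ p) (Submodule.factor hpI) (by
      ext
      simpa [Algebra.smul_def] using Ideal.Quotient.eq_zero_iff_mem.2 hxI)
  have hS : S.ShortExact := by
    refine ModuleCat.shortComplex_shortExact _ ?_ ?_ (Submodule.factor_surjective hpI)
    · intro y
      obtain ⟨r, rfl⟩ := Ideal.Quotient.mk_surjective y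
      change Ideal.Quotient.mk I r = 0 ↔ ∃ u, x • u = Ideal.Quotient.mk p r
      rw [Ideal.Quotient.eq_zero_iff_mem, Submodule.mem_sup]
      constructor
      · rintro ⟨s, hs, _, ht, rfl⟩
        obtain ⟨t, rfl⟩ := Ideal.mem_span_singleton'.1 ht
        refine ⟨Ideal.Quotient.mk p t, ?_⟩
        simp [Algebra.smul_def, Ideal.Quotient.eq_zero_iff_mem.2 hs, mul_comm]
      · rintro ⟨u, hu⟩
        obtain ⟨t, rfl⟩ := Ideal.Quotient.mk_surjective u
        refine ⟨r - x * t, ?_, x * t, Ideal.mem_span_singleton'.2 ⟨t, mul_comm _ _⟩, by ring⟩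
        rw [← Ideal.Quotient.eq_zero_iff_mem, map_sub, map_mul, ← hu]
        exact sub_self _
    · refine (injective_iff_map_eq_zero (x • LinearMap.id : (R ⧸ p) →ₗ[R] R ⧸ p)).2 fun y hy ↦ ?_
      obtain ⟨r, rfl⟩ := Ideal.Quotient.mk_surjective y
      have hy : Ideal.Quotient.mk p (x * r) = 0 := hy
      rw [Ideal.Quotient.eq_zero_iff_mem] at hy ⊢
      exact (hp.mem_or_mem hy).resolve_left hxp
  have hdiv := (ShortComplex.moduleCat_exact_iff _).1
    ((tensorComplex_map_shortExact P.complex hS).homology_exact₂ n)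
  refine subsingleton_of_telescope_injective (telescope_homology_bijective P
    (IsAdicComplete.telescope_bijective a hxa) n (ModuleCat.of R (R ⧸ p))).1 fun t ↦ ?_
  obtain ⟨u, hu⟩ := hdiv t (Subsingleton.elim (α := ((tensorComplex P.complex).obj
    (ModuleCat.of R (R ⧸ I))).homology n) _ _)
  refine ⟨u, Eq.trans ?_ hu⟩
  exact (ConcreteCategory.congr_hom
    (tensorComplex_homologyMap_smul P.complex (ModuleCat.of R (R ⧸ p)) x n) u).symm

open TensorProduct

lemma subsingleton_homology_succ_iff_exact (N : ModuleCat.{0} R) (n : ℕ) :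
    Subsingleton (((tensorComplex P.complex).obj N).homology (n + 1)) ↔
      Function.Exact ((P.complex.d (n + 2) (n + 1)).hom.lTensor N)
        ((P.complex.d (n + 1) n).hom.lTensor N) := by
  rw [← ModuleCat.isZero_iff_subsingleton, ← HomologicalComplex.exactAt_iff_isZero_homology,
    HomologicalComplex.exactAt_iff' _ (n + 2) (n + 1) n (by simp) (by simp)]
  change ((P.complex.sc' (n + 2) (n + 1) n).map (tensorLeft N)).Exact ↔ _
  rw [ShortComplex.ShortExact.moduleCat_exact_iff_function_exact]
  rfl

lemma exact_lTensor_of_forall_finite {A B C : Type*} [AddCommGroup A] [Module R A]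
    [AddCommGroup B] [Module R B] [AddCommGroup C] [Module R C] [Module.Flat R C]
    (f : A →ₗ[R] B) (g : B →ₗ[R] C) (hfg : g ∘ₗ f = 0)
    (N : Type*) [AddCommGroup N] [Module R N]
    (h : ∀ N' : Submodule R N, Module.Finite R N' →
      Function.Exact (f.lTensor N') (g.lTensor N')) :
    Function.Exact (f.lTensor N) (g.lTensor N) := by
  refine fun z ↦ ⟨fun hz ↦ ?_, ?_⟩
  · obtain ⟨N', hN', hz'⟩ :=
      TensorProduct.exists_finite_submodule_left_of_setFinite {z} (Set.finite_singleton z)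
    obtain ⟨z, rfl⟩ := hz' rfl
    have hz₀ : g.lTensor N' z = 0 := by
      apply Module.Flat.rTensor_preserves_injective_linearMap (M := C) N'.subtype
        N'.injective_subtype
      rw [map_zero, ← hz, ← LinearMap.comp_apply, ← LinearMap.comp_apply,
        LinearMap.rTensor_comp_lTensor, LinearMap.lTensor_comp_rTensor]
    obtain ⟨w, rfl⟩ := (h N' hN' z).1 hz₀
    refine ⟨N'.subtype.rTensor _ w, ?_⟩
    rw [← LinearMap.comp_apply, ← LinearMap.comp_apply, LinearMap.rTensor_comp_lTensor,
      LinearMap.lTensor_comp_rTensor]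
  · rintro ⟨w, rfl⟩
    rw [← LinearMap.comp_apply, ← LinearMap.lTensor_comp, hfg, LinearMap.lTensor_zero,
      LinearMap.zero_apply]

lemma subsingleton_homology_of_finite {n : ℕ}
    (h : ∀ (N : ModuleCat.{0} R) [Module.Finite R N],
      Subsingleton (((tensorComplex P.complex).obj N).homology (n + 1)))
    (N : ModuleCat.{0} R) :
    Subsingleton (((tensorComplex P.complex).obj N).homology (n + 1)) :=
  (subsingleton_homology_succ_iff_exact P N n).2 <|
    exact_lTensor_of_forall_finite _ _
      (ModuleCat.hom_ext_iff.1 (P.complex.d_comp_d (n + 2) (n + 1) n)) N fun N' _ ↦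
        (subsingleton_homology_succ_iff_exact P (ModuleCat.of R N') n).1 (h (ModuleCat.of R N'))

lemma subsingleton_homology_succ {n : ℕ}
    (h : ∀ N : ModuleCat.{0} R, Subsingleton (((tensorComplex P.complex).obj N).homology n))
    (N : ModuleCat.{0} R) :
    Subsingleton (((tensorComplex P.complex).obj N).homology (n + 1)) := by
  have hS := tensorComplex_map_shortExact P.complex
    (LinearMap.shortExact_shortComplexKer (Finsupp.linearCombination_id_surjective R N))
  rw [← ModuleCat.isZero_iff_subsingleton]
  exact (hS.homology_exact₃ (n + 1) n rfl).isZero_of_both_zeros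
    ((isZero_homology_of_flat P (ModuleCat.of R (N →₀ R)) n).eq_of_src _ _)
    ((ModuleCat.isZero_iff_subsingleton.2 (h _)).eq_of_tgt _ _)

end Resolution

/-- If `M` is `a`-adically complete and `Tor_n^R(R/p, M) = 0` for every prime
`p ⊇ a` (some `n ≥ 1`), then `Tor_n^R(N, M) = 0` for every `R`-module `N`; consequently the
flat dimension of `M` is at most `n - 1`, i.e. `Tor_i^R(N, M) = 0` for all `i ≥ n` and all `N`. -/
theorem tor_vanishing_of_adicComplete
    (R : Type) [CommRing R] [IsNoetherianRing R] (a : Ideal R)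
    (M : Type) [AddCommGroup M] [Module R M] [IsAdicComplete a M]
    (n : ℕ) (hn : 1 ≤ n)
    (hvan : ∀ (p : Ideal R), p.IsPrime → a ≤ p →
      Subsingleton (torModule R n (ModuleCat.of R (R ⧸ p)) (ModuleCat.of R M))) :
    (∀ N : ModuleCat R, Subsingleton (torModule R n N (ModuleCat.of R M))) ∧
      (∀ (N : ModuleCat R) (i : ℕ), n ≤ i →
        Subsingleton (torModule R i N (ModuleCat.of R M))) := by
  let P := projectiveResolution (ModuleCat.of R M)
  have iff (N : ModuleCat R) (i : ℕ) : Subsingleton (torModule R i N (ModuleCat.of R M)) ↔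
      Subsingleton (((tensorComplex P.complex).obj N).homology i) :=
    (torModuleIso P N i).toLinearEquiv.toEquiv.subsingleton_congr
  simp only [iff] at hvan ⊢
  obtain ⟨n, rfl⟩ := Nat.exists_eq_add_of_le' hn
  have : IsAdicComplete a (ModuleCat.of R M) := ‹IsAdicComplete a M›
  have h (N : ModuleCat R) :
      Subsingleton (((tensorComplex P.complex).obj N).homology (n + 1)) :=
    subsingleton_homology_of_finite P (fun N _ ↦ subsingleton_homology_of_le_annihilator P
      (I := ⊥) (fun q hq _ ↦ subsingleton_homology_quotient_prime P a hvan q hq) N bot_le) N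
  refine ⟨h, fun N i hi ↦ ?_⟩
  induction i, hi using Nat.le_induction generalizing N with
  | base => exact h N
  | succ i _ ih => exact subsingleton_homology_succ P ih N
end
end

section
/- Let (R, m, k) be a commutative noetherian local ring and M an m-torsion R-module, i.e., every element of M is annihilated by some power of m. If Ext^n_R(k, M) = 0 for some integer n ≥ 0, then the injective dimension of M is at most n − 1; in particular Ext^i_R(k, M) = 0 for all i ≥ n. -/
open CategoryTheory Opposite

noncomputable section

open Abelian Limits

/-- `Ext^n(X, Y)` vanishes iff every `n`-cocycle on a projective resolution of `X` is a
coboundary. -/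
theorem subsingleton_extModule_succ_iff {R : Type} [CommRing R] {X : ModuleCat R}
    (P : ProjectiveResolution X) (n : ℕ) (Y : ModuleCat R) :
    Subsingleton (extModule R (n + 1) X Y) ↔ ∀ f : P.complex.X (n + 1) ⟶ Y,
      P.complex.d (n + 2) (n + 1) ≫ f = 0 →
        ∃ g : P.complex.X n ⟶ Y, P.complex.d (n + 1) n ≫ g = f := by
  rw [← ModuleCat.isZero_iff_subsingleton, extModule, (P.isoExt (n + 1) Y).isZero_iff,
    ← HomologicalComplex.exactAt_iff_isZero_homology,
    HomologicalComplex.exactAt_iff' _ n (n + 1) (n + 2) (by simp) (by simp),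
    ShortComplex.moduleCat_exact_iff]
  exact Iff.rfl

theorem subsingleton_extModule_zero_iff {R : Type} [CommRing R] {X : ModuleCat R}
    (P : ProjectiveResolution X) (Y : ModuleCat R) :
    Subsingleton (extModule R 0 X Y) ↔ ∀ f : P.complex.X 0 ⟶ Y,
      P.complex.d 1 0 ≫ f = 0 → f = 0 := by
  rw [← ModuleCat.isZero_iff_subsingleton, extModule, (P.isoExt 0 Y).isZero_iff,
    ← HomologicalComplex.exactAt_iff_isZero_homology,
    HomologicalComplex.exactAt_iff' _ 0 0 1 (by simp) (by simp),
    ShortComplex.moduleCat_exact_iff]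
  constructor
  · intro h f hf
    obtain ⟨g, hg⟩ : ∃ g : P.complex.X 0 ⟶ Y, P.complex.d 0 0 ≫ g = f := h f hf
    rw [← hg, P.complex.shape 0 0 (by simp), zero_comp]
  · intro h f hf
    exact ⟨0, (map_zero _).trans (h f hf).symm⟩

/-- The `Ext` functors computed by projective resolutions vanish together with the `Ext` groups of
the derived category. -/
theorem subsingleton_extModule_iff {R : Type} [CommRing R] (n : ℕ) (X Y : ModuleCat R) :
    Subsingleton (extModule R n X Y) ↔ Subsingleton (Abelian.Ext X Y n) := by
  obtain ⟨P⟩ : Nonempty (ProjectiveResolution X) := ⟨projectiveResolution X⟩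
  rw [subsingleton_iff_forall_eq (0 : Abelian.Ext X Y n)]
  cases n with
  | zero =>
    rw [subsingleton_extModule_zero_iff P]
    let p : P.complex.X 0 ⟶ X := P.π.f 0
    have : Epi p := inferInstanceAs (Epi (P.π.f 0))
    have hp : P.complex.d 1 0 ≫ p = 0 := P.complex_d_comp_π_f_zero
    constructor
    · intro h e
      obtain ⟨g, rfl⟩ := Ext.addEquiv₀.symm.surjective e
      have hg : p ≫ g = 0 := h _ (by rw [reassoc_of% hp, zero_comp])
      rw [(cancel_epi p).1 (hg.trans comp_zero.symm), map_zero]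
    · intro h f hf
      obtain ⟨g, rfl⟩ : ∃ g : X ⟶ Y, p ≫ g = f := ⟨P.exact₀.desc f hf, P.exact₀.g_desc f hf⟩
      have hg : g = 0 := Ext.addEquiv₀.symm.injective ((h _).trans (map_zero _).symm)
      rw [hg, comp_zero]
  | succ n =>
    rw [subsingleton_extModule_succ_iff P]
    constructor
    · intro h e
      obtain ⟨f, hf, rfl⟩ := P.extMk_surjective e (n + 2) rfl
      exact (P.extMk_eq_zero_iff f (n + 2) rfl hf n rfl).2 (h f hf)
    · intro h f hf
      exact (P.extMk_eq_zero_iff f (n + 2) rfl hf n rfl).1 (h _)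

/-- Vanishing of `Ext^n(k, M)` propagates to every finite module killed by a power of the
maximal ideal. -/
theorem subsingleton_ext_of_pow_smul_eq_zero {R : Type} [CommRing R] [IsNoetherianRing R]
    [IsLocalRing R] (M : ModuleCat R) (n : ℕ)
    (h : Subsingleton (Abelian.Ext (ModuleCat.of R (IsLocalRing.ResidueField R)) M n))
    (N : Type) [AddCommGroup N] [Module R N] [hN : Module.Finite R N] (s : ℕ)
    (hs : ∀ r ∈ IsLocalRing.maximalIdeal R ^ s, ∀ x : N, r • x = 0) :
    Subsingleton (Abelian.Ext (ModuleCat.of R N) M n) := by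
  induction hN using IsNoetherianRing.induction_on_isQuotientEquivQuotientPrime R with
  | subsingleton N =>
    rw [subsingleton_iff_forall_eq 0]
    intro e
    have : 𝟙 (ModuleCat.of R N) = 0 := by
      ext; subsingleton
    rw [← Ext.mk₀_id_comp e, this, Ext.mk₀_zero, Ext.zero_comp]
  | quotient N p f =>
    have hle : IsLocalRing.maximalIdeal R ≤ p.1 := by
      refine p.2.le_of_pow_le (n := s) fun r hr ↦ ?_
      have := congrArg f (hs r hr (f.symm 1))
      rw [map_smul, f.apply_symm_apply, map_zero, Algebra.smul_def, mul_one] at this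
      exact Ideal.Quotient.eq_zero_iff_mem.1 this
    have hp : p.1 = IsLocalRing.maximalIdeal R :=
      ((IsLocalRing.maximalIdeal.isMaximal R).eq_of_le p.2.ne_top hle).symm
    let e : N ≃ₗ[R] IsLocalRing.ResidueField R := f.trans (Submodule.quotEquivOfEq _ _ hp)
    rw [subsingleton_iff_forall_eq 0]
    intro x
    rw [← Ext.mk₀_id_comp x, ← e.toModuleIso.hom_inv_id, ← Ext.mk₀_comp_mk₀_assoc,
      Subsingleton.elim ((Ext.mk₀ e.toModuleIso.inv).comp x (zero_add n)) 0, Ext.comp_zero]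
  | exact N₁ N₂ N₃ f g hf hg hfg h₁ h₃ =>
    have h₁ := h₁ fun r hr x ↦ hf (by rw [map_smul, hs r hr, map_zero])
    have h₃ := h₃ fun r hr x ↦ by
      obtain ⟨y, rfl⟩ := hg x
      rw [← map_smul, hs r hr, map_zero]
    let S : ShortComplex (ModuleCat R) :=
      ModuleCat.shortComplexOfCompEqZero f g hfg.linearMap_comp_eq_zero
    have hS : S.ShortExact := ModuleCat.shortComplex_shortExact S hfg hf hg
    rw [subsingleton_iff_forall_eq 0]
    intro x
    obtain ⟨y, rfl⟩ := Ext.contravariant_sequence_exact₂ hS M x (h₁.elim _ _)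
    rw [show y = 0 from h₃.elim _ _, Ext.comp_zero]

/-- If an `𝔞`-power torsion module `M` over a noetherian ring admits extensions of all maps from
ideals containing a power of `𝔞`, then it is injective. -/
theorem baer_of_extends_of_pow_le {R M : Type} [CommRing R] [IsNoetherianRing R]
    [AddCommGroup M] [Module R M] (𝔞 : Ideal R)
    (htor : ∀ x : M, ∃ t : ℕ, ∀ r ∈ 𝔞 ^ t, r • x = 0)
    (hext : ∀ (I : Ideal R) (s : ℕ) (hs : 𝔞 ^ s ≤ I) (g : I →ₗ[R] M),
      (∀ r (hr : r ∈ 𝔞 ^ s), g ⟨r, hs hr⟩ = 0) →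
        ∃ g' : R →ₗ[R] M, ∀ (x : R) (hx : x ∈ I), g' x = g ⟨x, hx⟩) :
    Module.Baer R M := by
  intro I g
  obtain ⟨t, ht⟩ : ∃ t : ℕ, ∀ r ∈ 𝔞 ^ t, ∀ x : I, r • g x = 0 := by
    obtain ⟨S, hS⟩ := (Module.finite_def (R := R) (M := I)).1 inferInstance
    choose t ht using htor
    refine ⟨S.sup fun x ↦ t (g x), fun r hr x ↦ ?_⟩
    suffices Submodule.span R (S : Set I) ≤ LinearMap.ker (r • g) from
      this (hS ▸ Submodule.mem_top)
    refine Submodule.span_le.2 fun y hy ↦ ht (g y) r ?_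
    exact Ideal.pow_le_pow_right (Finset.le_sup (f := fun x ↦ t (g x)) hy) hr
  obtain ⟨k, hk⟩ := Ideal.exists_pow_inf_eq_pow_smul 𝔞 (I : Submodule R R)
  have hle : 𝔞 ^ (t + k) ⊓ I ≤ 𝔞 ^ t * I := by
    have := hk (t + k) (by lia)
    simp only [smul_eq_mul, Ideal.mul_top, Nat.add_sub_cancel] at this
    rw [this]
    exact Ideal.mul_mono_right inf_le_right
  have hg : ∀ (x : R) (hx : x ∈ I), x ∈ 𝔞 ^ (t + k) → g ⟨x, hx⟩ = 0 := by
    intro x hx hxk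
    suffices h : 𝔞 ^ t * I ≤ (LinearMap.ker g).map I.subtype by
      obtain ⟨y, hy, rfl⟩ := h (hle ⟨hxk, hx⟩)
      exact hy
    refine Ideal.mul_le.2 fun r hr y hy ↦ ⟨r • ⟨y, hy⟩, ?_, rfl⟩
    exact (map_smul g r ⟨y, hy⟩).trans (ht r hr _)
  let f₁ : R →ₗ.[R] M := ⟨I, g⟩
  let f₂ : R →ₗ.[R] M := ⟨𝔞 ^ (t + k), 0⟩
  have hf : ∀ (x : f₁.domain) (y : f₂.domain), (x : R) = y → f₁ x = f₂ y := by
    rintro ⟨x, hx⟩ ⟨y, hy⟩ rfl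
    exact hg x hx hy
  obtain ⟨g', hg'⟩ := hext (f₁.sup f₂ hf).domain (t + k) (f₁.right_le_sup f₂ hf).1
    (f₁.sup f₂ hf).toFun fun r hr ↦
      ((f₁.right_le_sup f₂ hf).2 (x := ⟨r, hr⟩) rfl).symm
  exact ⟨g', fun x hx ↦ (hg' x ((f₁.left_le_sup f₂ hf).1 hx)).trans
    ((f₁.left_le_sup f₂ hf).2 (x := ⟨x, hx⟩) rfl).symm⟩

/-- The submodule of elements killed by a power of the ideal `𝔞`. -/
def powTorsion {R : Type} [CommRing R] (𝔞 : Ideal R) (M : Type) [AddCommGroup M] [Module R M] :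
    Submodule R M where
  carrier := {x | ∃ t : ℕ, ∀ r ∈ 𝔞 ^ t, r • x = 0}
  zero_mem' := ⟨0, fun r _ ↦ smul_zero r⟩
  add_mem' := by
    rintro x y ⟨s, hs⟩ ⟨t, ht⟩
    refine ⟨max s t, fun r hr ↦ ?_⟩
    rw [smul_add, hs r (Ideal.pow_le_pow_right (le_max_left s t) hr),
      ht r (Ideal.pow_le_pow_right (le_max_right s t) hr), add_zero]
  smul_mem' := by
    rintro c x ⟨t, ht⟩
    exact ⟨t, fun r hr ↦ by rw [smul_comm, ht r hr, smul_zero]⟩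

/-- Over a noetherian ring, the power torsion of an injective module is injective. -/
theorem injective_powTorsion {R J : Type} [CommRing R] [IsNoetherianRing R]
    [AddCommGroup J] [Module R J] (𝔞 : Ideal R) [Module.Injective R J] :
    Module.Injective R (powTorsion 𝔞 J) := by
  refine (baer_of_extends_of_pow_le 𝔞 (fun x ↦ ?_) fun I s hs g hg ↦ ?_).injective
  · obtain ⟨t, ht⟩ := x.2
    exact ⟨t, fun r hr ↦ Subtype.ext (ht r hr)⟩
  · obtain ⟨g', hg'⟩ := Module.Baer.of_injective ‹_› I ((powTorsion 𝔞 J).subtype ∘ₗ g)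
    have hmem : g' 1 ∈ powTorsion 𝔞 J := ⟨s, fun r hr ↦ by
      rw [← map_smul, smul_eq_mul, mul_one, hg' r (hs hr), LinearMap.comp_apply, hg r hr,
        map_zero]⟩
    refine ⟨LinearMap.toSpanSingleton R _ ⟨g' 1, hmem⟩, fun x hx ↦ Subtype.ext ?_⟩
    change x • g' 1 = _
    rw [← map_smul, smul_eq_mul, mul_one, hg' x hx]
    rfl

/-- A torsion module `M` over a noetherian local ring with `Ext^1(k, M) = 0` is injective. -/
theorem injective_of_subsingleton_ext_one {R M : Type} [CommRing R] [IsNoetherianRing R]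
    [IsLocalRing R] [AddCommGroup M] [Module R M]
    (htor : ∀ x : M, ∃ t : ℕ, ∀ r ∈ IsLocalRing.maximalIdeal R ^ t, r • x = 0)
    (h : Subsingleton (Abelian.Ext (ModuleCat.of R (IsLocalRing.ResidueField R))
      (ModuleCat.of R M) 1)) :
    Module.Injective R M := by
  refine (baer_of_extends_of_pow_le _ htor fun I s hs g _ ↦ ?_).injective
  have hI : Subsingleton (Abelian.Ext (ModuleCat.of R (R ⧸ I)) (ModuleCat.of R M) 1) := by
    refine subsingleton_ext_of_pow_smul_eq_zero _ 1 h (R ⧸ I) s fun r hr x ↦ ?_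
    obtain ⟨y, rfl⟩ := Submodule.mkQ_surjective I x
    rw [← map_smul]
    exact (Submodule.Quotient.mk_eq_zero I).2 (I.mul_mem_right y (hs hr))
  let S : ShortComplex (ModuleCat R) :=
    ModuleCat.shortComplexOfCompEqZero I.subtype I.mkQ
      (LinearMap.exact_subtype_mkQ I).linearMap_comp_eq_zero
  have hS : S.ShortExact := ModuleCat.shortComplex_shortExact S (LinearMap.exact_subtype_mkQ I)
    I.injective_subtype I.mkQ_surjective
  obtain ⟨e, he⟩ := Ext.contravariant_sequence_exact₁ hS _ (Ext.mk₀ (ModuleCat.ofHom g)) rfl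
    (hI.elim _ _)
  obtain ⟨g', rfl⟩ := Ext.addEquiv₀.symm.surjective e
  have he' : S.f ≫ g' = ModuleCat.ofHom g :=
    Ext.addEquiv₀.symm.injective ((Ext.mk₀_comp_mk₀ _ _).symm.trans he)
  exact ⟨g'.hom, fun x hx ↦ LinearMap.congr_fun (congrArg ModuleCat.Hom.hom he') ⟨x, hx⟩⟩

theorem subsingleton_of_subsingleton_ext_zero {R M : Type} [CommRing R] [IsNoetherianRing R]
    [IsLocalRing R] [AddCommGroup M] [Module R M]
    (htor : ∀ x : M, ∃ t : ℕ, ∀ r ∈ IsLocalRing.maximalIdeal R ^ t, r • x = 0)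
    (h : Subsingleton (Abelian.Ext (ModuleCat.of R (IsLocalRing.ResidueField R))
      (ModuleCat.of R M) 0)) :
    Subsingleton M := by
  rw [subsingleton_iff_forall_eq 0]
  intro x
  obtain ⟨t, ht⟩ := htor x
  have hx : Subsingleton (Abelian.Ext (ModuleCat.of R (R ∙ x)) (ModuleCat.of R M) 0) := by
    refine subsingleton_ext_of_pow_smul_eq_zero _ 0 h (R ∙ x) t fun r hr y ↦ Subtype.ext ?_
    obtain ⟨c, hc⟩ := Submodule.mem_span_singleton.1 y.2
    rw [Submodule.coe_smul, ← hc, smul_comm, ht r hr, smul_zero, Submodule.coe_zero]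
  have h0 : ModuleCat.ofHom (R ∙ x).subtype = 0 :=
    Ext.addEquiv₀.symm.injective (hx.elim _ _)
  exact LinearMap.congr_fun (congrArg ModuleCat.Hom.hom h0) ⟨x, Submodule.mem_span_singleton_self x⟩

/-- Over a noetherian local ring, a torsion module `M` with `Ext^n(k, M) = 0` has injective
dimension less than `n`. -/
theorem hasInjectiveDimensionLT_of_subsingleton_ext {R M : Type} [CommRing R]
    [IsNoetherianRing R] [IsLocalRing R] [AddCommGroup M] [Module R M]
    (htor : ∀ x : M, ∃ t : ℕ, ∀ r ∈ IsLocalRing.maximalIdeal R ^ t, r • x = 0) (n : ℕ)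
    (h : Subsingleton (Abelian.Ext (ModuleCat.of R (IsLocalRing.ResidueField R))
      (ModuleCat.of R M) n)) :
    HasInjectiveDimensionLT (ModuleCat.of R M) n := by
  induction n generalizing M with
  | zero =>
    have := subsingleton_of_subsingleton_ext_zero htor h
    exact (ModuleCat.isZero_of_subsingleton _).hasInjectiveDimensionLT_zero
  | succ n ih =>
    obtain rfl | n := n
    · have := injective_of_subsingleton_ext_one htor h
      have := Module.injective_object_of_injective_module R M
      infer_instance
    let J := Injective.under (ModuleCat.of R M)
    have hJ : Injective J := inferInstance
    have : Module.Injective R J := Module.injective_module_of_injective_object R J (inj := hJ)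
    let E := powTorsion (IsLocalRing.maximalIdeal R) J
    let f : M →ₗ[R] E := (Injective.ι (ModuleCat.of R M)).hom.codRestrict E fun x ↦ by
      obtain ⟨t, ht⟩ := htor x
      exact ⟨t, fun r hr ↦ by rw [← map_smul, ht r hr, map_zero]⟩
    have hf : Function.Injective f := (LinearMap.injective_codRestrict_iff _).2
      ((ModuleCat.mono_iff_injective _).1 inferInstance)
    let S : ShortComplex (ModuleCat R) :=
      ModuleCat.shortComplexOfCompEqZero _ _ f.exact_map_mkQ_range.linearMap_comp_eq_zero
    have hS : S.ShortExact := ModuleCat.shortComplex_shortExact S f.exact_map_mkQ_range hf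
      (Submodule.mkQ_surjective _)
    have hE : Injective S.X₂ :=
      have := injective_powTorsion (J := J) (IsLocalRing.maximalIdeal R)
      Module.injective_object_of_injective_module R E
    refine (hS.hasInjectiveDimensionLT_X₃_iff n hE).1 (ih (M := E ⧸ f.range) (fun x ↦ ?_) ?_)
    · obtain ⟨y, rfl⟩ := Submodule.mkQ_surjective _ x
      obtain ⟨t, ht⟩ := y.2
      exact ⟨t, fun r hr ↦ by rw [← map_smul, show r • y = 0 from Subtype.ext (ht r hr), map_zero]⟩
    · rw [subsingleton_iff_forall_eq 0]
      intro e
      obtain ⟨e', rfl⟩ := Ext.covariant_sequence_exact₃ _ hS e rfl (h.elim _ _)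
      rw [Ext.eq_zero_of_injective e', Ext.zero_comp]

/-- `(R, m, k)` local noetherian, `M` an `m`-torsion module. If
`Ext^n_R(k, M) = 0` then the injective dimension of `M` is at most `n - 1`
(i.e. `Ext^i_R(N, M) = 0` for all `N` and all `i ≥ n`; for `n = 0` this forces `M = 0`);
in particular `Ext^i_R(k, M) = 0` for all `i ≥ n`. -/
theorem injDim_lt_of_torsion_ext_vanishing
    (R : Type) [CommRing R] [IsNoetherianRing R] [IsLocalRing R]
    (M : Type) [AddCommGroup M] [Module R M]
    (htor : ∀ x : M, ∃ t : ℕ, ∀ r ∈ (IsLocalRing.maximalIdeal R) ^ t, r • x = 0)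
    (n : ℕ)
    (hvan : Subsingleton (extModule R n
      (ModuleCat.of R (IsLocalRing.ResidueField R)) (ModuleCat.of R M))) :
    (∀ (N : ModuleCat R) (i : ℕ), n ≤ i →
      Subsingleton (extModule R i N (ModuleCat.of R M))) ∧
    (∀ i : ℕ, n ≤ i → Subsingleton (extModule R i
      (ModuleCat.of R (IsLocalRing.ResidueField R)) (ModuleCat.of R M))) := by
  have := hasInjectiveDimensionLT_of_subsingleton_ext htor n
    ((subsingleton_extModule_iff _ _ _).1 hvan)
  have key (N : ModuleCat R) (i : ℕ) (hi : n ≤ i) :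
      Subsingleton (extModule R i N (ModuleCat.of R M)) :=
    (subsingleton_extModule_iff _ _ _).2
      (HasInjectiveDimensionLT.subsingleton (ModuleCat.of R M) n i hi N)
  exact ⟨key, key _⟩
end
end
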